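/- Let g̃ : S → ℝ be continuously differentiable, let M, L > 0, and let ρᵈ : ℝ≥0 × S → ℝ be continuously differentiable with ‖ρᵈ(t,·)‖₂ ≤ M and ‖ρᵈ_x(t,·)‖₂ ≤ L for all t ≥ 0. Let e : ℝ≥0 × S → ℝ be a continuously differentiable solution (C¹ in t, C² in x) of e_t = −K_p e + [e Ũᵈ]_x + [ρᵈ Ũᵉ]_x − [e Ũᵉ]_x, where Ũᵈ(t,·) = g̃ * ρᵈ(t,·) and Ũᵉ(t,·) = g̃ * e(t,·). Then for all t ≥ 0, the time derivative of ‖e(t,·)‖₂² is at most ( −2K_p + 3M‖g̃_x‖₂ + 2L‖g̃‖₂ + ‖g̃_x‖₂ ‖e(t,·)‖₂ ) ‖e(t,·)‖₂². -/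

import Mathlib

open MeasureTheory Real Filter

/-- The `L²`-norm on the circle `S = [-π, π]` (endpoints identified). -/
noncomputable def L2norm (h : ℝ → ℝ) : ℝ :=
  Real.sqrt (∫ x in (-Real.pi)..Real.pi, h x ^ 2)

/-- Circular convolution on `S = [-π, π]`. -/
noncomputable def circConv (f g : ℝ → ℝ) : ℝ → ℝ :=
  fun x => ∫ y in (-Real.pi)..Real.pi, f (x - y) * g y

/-- Differentiation under the integral sign on a compact interval, for an integrand with jointly
continuous partial derivative. -/
theorem hasDerivAt_intervalIntegral_of_continuous {F F' : ℝ → ℝ → ℝ} (a b : ℝ)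
    (hF : ∀ s, Continuous (F s)) (hF' : Continuous (Function.uncurry F'))
    (hderiv : ∀ s x, HasDerivAt (fun s => F s x) (F' s x) s) (s₀ : ℝ) :
    HasDerivAt (fun s => ∫ x in a..b, F s x) (∫ x in a..b, F' s₀ x) s₀ := by
  obtain ⟨C, hC⟩ := ((isCompact_closedBall s₀ 1).prod
    (isCompact_uIcc (a := a) (b := b))).exists_bound_of_continuousOn hF'.continuousOn
  refine (intervalIntegral.hasDerivAt_integral_of_dominated_loc_of_deriv_le
    (bound := fun _ => C) (Metric.ball_mem_nhds s₀ one_pos)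
    (Eventually.of_forall fun s => (hF s).aestronglyMeasurable)
    ((hF s₀).intervalIntegrable _ _)
    (hF'.comp (Continuous.prodMk_right s₀)).aestronglyMeasurable
    (Eventually.of_forall fun x hx s hs => ?_) intervalIntegrable_const
    (Eventually.of_forall fun x _ s _ => hderiv s x)).2
  exact hC (s, x) ⟨Metric.ball_subset_closedBall hs, Set.uIoc_subset_uIcc hx⟩

theorem L2norm_nonneg (f : ℝ → ℝ) : 0 ≤ L2norm f := Real.sqrt_nonneg _

theorem L2norm_sq (f : ℝ → ℝ) : L2norm f ^ 2 = ∫ x in (-Real.pi)..Real.pi, f x ^ 2 :=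
  Real.sq_sqrt (intervalIntegral.integral_nonneg (by linarith [Real.pi_pos])
    fun x _ => sq_nonneg (f x))

/-- The Cauchy–Schwarz inequality for continuous functions. -/
theorem abs_integral_mul_le_L2norm {f g : ℝ → ℝ} (hf : Continuous f) (hg : Continuous g) :
    |∫ x in (-Real.pi)..Real.pi, f x * g x| ≤ L2norm f * L2norm g := by
  have h := discrim_le_zero (a := L2norm f ^ 2)
    (b := 2 * ∫ x in (-Real.pi)..Real.pi, f x * g x) (c := L2norm g ^ 2) fun s => by
      have h0 : 0 ≤ ∫ x in (-Real.pi)..Real.pi, (s * f x + g x) ^ 2 :=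
        intervalIntegral.integral_nonneg (by linarith [Real.pi_pos]) fun x _ => sq_nonneg _
      have h1 : ∫ x in (-Real.pi)..Real.pi, (s * f x + g x) ^ 2 =
          ∫ x in (-Real.pi)..Real.pi,
            ((s * s) * f x ^ 2 + (2 * s) * (f x * g x) + g x ^ 2) := by
        congr 1; ext x; ring
      rw [h1, intervalIntegral.integral_add, intervalIntegral.integral_add,
        intervalIntegral.integral_const_mul, intervalIntegral.integral_const_mul,
        ← L2norm_sq, ← L2norm_sq] at h0
      · linarith
      all_goals exact Continuous.intervalIntegrable (by fun_prop) _ _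
  refine abs_le_of_sq_le_sq ?_ (mul_nonneg (L2norm_nonneg f) (L2norm_nonneg g))
  unfold discrim at h
  nlinarith

theorem L2norm_comp_sub_left {g : ℝ → ℝ} (hg : Function.Periodic g (2 * Real.pi)) (x : ℝ) :
    L2norm (fun y => g (x - y)) = L2norm g := by
  unfold L2norm
  congr 1
  rw [intervalIntegral.integral_comp_sub_left (fun y => g y ^ 2) x]
  have hp : Function.Periodic (fun y => g y ^ 2) (2 * Real.pi) := fun y => by simp only [hg y]
  have h := hp.intervalIntegral_add_eq (x - Real.pi) (-Real.pi)
  convert h using 2 <;> ring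

theorem abs_circConv_le {g f : ℝ → ℝ} (hg : Continuous g)
    (hgper : Function.Periodic g (2 * Real.pi)) (hf : Continuous f) (x : ℝ) :
    |circConv g f x| ≤ L2norm g * L2norm f := by
  rw [← L2norm_comp_sub_left hgper x]
  exact abs_integral_mul_le_L2norm (by fun_prop) hf

theorem continuous_circConv {g f : ℝ → ℝ} (hg : Continuous g) (hf : Continuous f) :
    Continuous (circConv g f) :=
  intervalIntegral.continuous_parametric_intervalIntegral_of_continuous' (by fun_prop) _ _

theorem periodic_circConv {g : ℝ → ℝ} {c : ℝ} (hg : Function.Periodic g c) (f : ℝ → ℝ) :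
    Function.Periodic (circConv g f) c := fun x => by
  simp only [circConv, add_sub_right_comm x c, hg _]

theorem hasDerivAt_circConv {g f : ℝ → ℝ} (hg : ContDiff ℝ 1 g) (hf : Continuous f) (x : ℝ) :
    HasDerivAt (circConv g f) (circConv (deriv g) f x) x := by
  have hg' : Continuous (deriv g) := hg.continuous_deriv le_rfl
  have hgc := hg.continuous
  refine hasDerivAt_intervalIntegral_of_continuous (F := fun x y => g (x - y) * f y)
    (F' := fun x y => deriv g (x - y) * f y) _ _ (fun s => by fun_prop) (by fun_prop)
    (fun s y => ?_) x
  exact (((hg.differentiable one_ne_zero) (s - y)).hasDerivAt.comp_sub_const s y).mul_const _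

theorem periodic_deriv {g : ℝ → ℝ} {c : ℝ} (hg : Function.Periodic g c) :
    Function.Periodic (deriv g) c := fun x => by
  rw [← deriv_comp_add_const, show (fun x => g (x + c)) = g from funext hg]

/-- Integrating by parts, `2 ∫ u (u V)_x = ∫ u² V_x` for periodic `u` and `V`. -/
theorem two_mul_integral_mul_deriv_mul {u V u' V' : ℝ → ℝ}
    (hu : ∀ x, HasDerivAt u (u' x) x) (hV : ∀ x, HasDerivAt V (V' x) x)
    (hu' : Continuous u') (hV' : Continuous V')
    (huper : Function.Periodic u (2 * Real.pi)) (hVper : Function.Periodic V (2 * Real.pi)) :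
    2 * ∫ x in (-Real.pi)..Real.pi, u x * (u' x * V x + u x * V' x) =
      ∫ x in (-Real.pi)..Real.pi, u x ^ 2 * V' x := by
  have huc : Continuous u := continuous_iff_continuousAt.2 fun x => (hu x).continuousAt
  have hVc : Continuous V := continuous_iff_continuousAt.2 fun x => (hV x).continuousAt
  have hd : ∀ x, HasDerivAt (fun x => u x ^ 2 * V x)
      (2 * (u x * (u' x * V x + u x * V' x)) - u x ^ 2 * V' x) x := fun x => by
    refine (((hu x).fun_pow 2).fun_mul (hV x)).congr_deriv ?_
    norm_num
    ring
  have h := intervalIntegral.integral_eq_sub_of_hasDerivAt (a := -Real.pi) (b := Real.pi)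
    (fun x _ => hd x) (Continuous.intervalIntegrable (by fun_prop) _ _)
  have e1 : u Real.pi = u (-Real.pi) := by rw [← huper (-Real.pi)]; ring_nf
  have e2 : V Real.pi = V (-Real.pi) := by rw [← hVper (-Real.pi)]; ring_nf
  rw [e1, e2, sub_self, intervalIntegral.integral_sub, intervalIntegral.integral_const_mul] at h
  · linarith
  all_goals exact Continuous.intervalIntegrable (by fun_prop) _ _

theorem abs_integral_sq_mul_le {u W : ℝ → ℝ} {C : ℝ} (hu : Continuous u) (hW : Continuous W)
    (hC : ∀ x, |W x| ≤ C) :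
    |∫ x in (-Real.pi)..Real.pi, u x ^ 2 * W x| ≤ C * L2norm u ^ 2 := by
  rw [L2norm_sq, ← intervalIntegral.integral_const_mul]
  refine (intervalIntegral.abs_integral_le_integral_abs (by linarith [Real.pi_pos])).trans
    (intervalIntegral.integral_mono_on (by linarith [Real.pi_pos])
      (Continuous.intervalIntegrable (by fun_prop) _ _)
      (Continuous.intervalIntegrable (by fun_prop) _ _) fun x _ => ?_)
  rw [abs_mul, abs_of_nonneg (sq_nonneg (u x)), mul_comm]
  exact mul_le_mul_of_nonneg_right (hC x) (sq_nonneg _)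

theorem abs_integral_mul_mul_le {u v W : ℝ → ℝ} {C : ℝ} (hu : Continuous u) (hv : Continuous v)
    (hW : Continuous W) (hC : ∀ x, |W x| ≤ C) :
    |∫ x in (-Real.pi)..Real.pi, u x * (v x * W x)| ≤ C * (L2norm u * L2norm v) := by
  have hC0 : 0 ≤ C := (abs_nonneg _).trans (hC 0)
  have hvW : L2norm (fun x => v x * W x) ≤ C * L2norm v := by
    refine abs_le_of_sq_le_sq' ?_ (mul_nonneg hC0 (L2norm_nonneg v)) |>.2
    rw [L2norm_sq, mul_pow, L2norm_sq, ← intervalIntegral.integral_const_mul]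
    refine intervalIntegral.integral_mono_on (by linarith [Real.pi_pos])
      (Continuous.intervalIntegrable (by fun_prop) _ _)
      (Continuous.intervalIntegrable (by fun_prop) _ _) fun x _ => ?_
    rw [mul_pow, mul_comm]
    exact mul_le_mul_of_nonneg_right (sq_le_sq.2 ((hC x).trans (le_abs_self C))) (sq_nonneg _)
  calc |∫ x in (-Real.pi)..Real.pi, u x * (v x * W x)|
      ≤ L2norm u * L2norm (fun x => v x * W x) := abs_integral_mul_le_L2norm hu (by fun_prop)
    _ ≤ L2norm u * (C * L2norm v) := mul_le_mul_of_nonneg_left hvW (L2norm_nonneg u)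
    _ = C * (L2norm u * L2norm v) := by ring

/-- **Equation (35) of the paper.** Differential inequality for `‖e(t,·)‖₂²` under
a perturbed interaction kernel with mismatch `g̃`, where `Ũᵈ(t,·) = g̃ * ρᵈ(t,·)`
and `Ũᵉ(t,·) = g̃ * e(t,·)`. -/
theorem norm_sq_diff_ineq_kernel_perturbation
    (gTilde : ℝ → ℝ) (hg : ContDiff ℝ 1 gTilde)
    (hgper : Function.Periodic gTilde (2 * Real.pi))
    (M L : ℝ) (hM : 0 < M) (hL : 0 < L)
    (ρd : ℝ → ℝ → ℝ)
    (hρd : ContDiff ℝ 1 (fun p : ℝ × ℝ => ρd p.1 p.2))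
    (hρdper : ∀ t, Function.Periodic (ρd t) (2 * Real.pi))
    (hρdM : ∀ t, 0 ≤ t → L2norm (ρd t) ≤ M)
    (hρdL : ∀ t, 0 ≤ t → L2norm (fun x => deriv (ρd t) x) ≤ L)
    (Kp : ℝ)
    (e : ℝ → ℝ → ℝ)
    (he1 : ContDiff ℝ 1 (fun p : ℝ × ℝ => e p.1 p.2))
    (he2 : ∀ t, ContDiff ℝ 2 (e t))
    (heper : ∀ t, Function.Periodic (e t) (2 * Real.pi))
    (hdyn : ∀ t, 0 ≤ t → ∀ x : ℝ,
      HasDerivAt (fun τ => e τ x)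
        (-Kp * e t x
          + deriv (fun y => e t y * circConv gTilde (ρd t) y) x
          + deriv (fun y => ρd t y * circConv gTilde (e t) y) x
          - deriv (fun y => e t y * circConv gTilde (e t) y) x) t) :
    ∀ t, 0 ≤ t → ∃ y : ℝ,
      HasDerivAt (fun τ => ∫ x in (-Real.pi)..Real.pi, e τ x ^ 2) y t ∧
        y ≤ (-(2 * Kp) + 3 * M * L2norm (fun x => deriv gTilde x)
              + 2 * L * L2norm gTilde
              + L2norm (fun x => deriv gTilde x) * L2norm (e t)) * L2norm (e t) ^ 2 := by
  intro t ht
  have hg' : Continuous (deriv gTilde) := hg.continuous_deriv le_rfl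
  have hgper' : Function.Periodic (deriv gTilde) (2 * Real.pi) := periodic_deriv hgper
  have hρ1 : ContDiff ℝ 1 (ρd t) := hρd.comp (contDiff_prodMk_right t)
  have he1t : ContDiff ℝ 1 (e t) := (he2 t).of_le (by norm_num)
  have hρc := hρ1.continuous
  have hec := he1t.continuous
  have hρ'c : Continuous (deriv (ρd t)) := hρ1.continuous_deriv le_rfl
  have he'c : Continuous (deriv (e t)) := he1t.continuous_deriv le_rfl
  have hρder : ∀ x, HasDerivAt (ρd t) (deriv (ρd t) x) x := fun x =>
    (hρ1.differentiable one_ne_zero x).hasDerivAt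
  have heder : ∀ x, HasDerivAt (e t) (deriv (e t) x) x := fun x =>
    (he1t.differentiable one_ne_zero x).hasDerivAt
  have hVder := hasDerivAt_circConv hg hρc
  have hUder := hasDerivAt_circConv hg hec
  have hVc := continuous_circConv hg.continuous hρc
  have hUc := continuous_circConv hg.continuous hec
  have hV'c := continuous_circConv hg' hρc
  have hU'c := continuous_circConv hg' hec
  have hdt : ∀ s x, HasDerivAt (fun s => e s x)
      (fderiv ℝ (fun p : ℝ × ℝ => e p.1 p.2) (s, x) (1, 0)) s := fun s x =>
    HasFDerivAt.comp_hasDerivAt (f := fun s => (s, x)) s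
      (he1.differentiable one_ne_zero (s, x)).hasFDerivAt
      ((hasDerivAt_id s).prodMk (hasDerivAt_const s x))
  have hdtc : Continuous (fun p : ℝ × ℝ =>
      fderiv ℝ (fun p : ℝ × ℝ => e p.1 p.2) p (1, 0)) :=
    (he1.continuous_fderiv one_ne_zero).clm_apply continuous_const
  have hJ := hasDerivAt_intervalIntegral_of_continuous (F := fun s x => e s x ^ 2)
    (F' := fun s x => 2 * e s x * fderiv ℝ (fun p : ℝ × ℝ => e p.1 p.2) (s, x) (1, 0))
    (-Real.pi) Real.pi (fun s => (he2 s).continuous.pow 2)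
    ((continuous_const.mul he1.continuous).mul hdtc)
    (fun s x => by simpa using (hdt s x).fun_pow 2) t
  refine ⟨_, hJ, ?_⟩
  have key : ∫ x in (-Real.pi)..Real.pi,
        2 * e t x * fderiv ℝ (fun p : ℝ × ℝ => e p.1 p.2) (t, x) (1, 0) =
      ∫ x in (-Real.pi)..Real.pi,
        (-(2 * Kp) * e t x ^ 2
          + 2 * (e t x * (deriv (e t) x * circConv gTilde (ρd t) x
            + e t x * circConv (deriv gTilde) (ρd t) x))
          + 2 * (e t x * (deriv (ρd t) x * circConv gTilde (e t) x))
          + 2 * (e t x * (ρd t x * circConv (deriv gTilde) (e t) x))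
          - 2 * (e t x * (deriv (e t) x * circConv gTilde (e t) x
            + e t x * circConv (deriv gTilde) (e t) x))) := by
    congr 1
    ext x
    rw [(hdt t x).unique (hdyn t ht x), ((heder x).fun_mul (hVder x)).deriv,
      ((hρder x).fun_mul (hUder x)).deriv, ((heder x).fun_mul (hUder x)).deriv]
    ring
  rw [key, intervalIntegral.integral_sub, intervalIntegral.integral_add,
    intervalIntegral.integral_add, intervalIntegral.integral_add]
  · simp only [intervalIntegral.integral_const_mul]
    rw [two_mul_integral_mul_deriv_mul heder hVder he'c hV'c (heper t)
        (periodic_circConv hgper _),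
      two_mul_integral_mul_deriv_mul heder hUder he'c hU'c (heper t)
        (periodic_circConv hgper _), ← L2norm_sq]
    have b1 := (abs_le.1 (abs_integral_sq_mul_le hec hV'c (abs_circConv_le hg' hgper' hρc))).2
    have b2 := (abs_le.1 (abs_integral_mul_mul_le hec hρ'c hUc
      (abs_circConv_le hg.continuous hgper hec))).2
    have b3 := (abs_le.1 (abs_integral_mul_mul_le hec hρc hU'c
      (abs_circConv_le hg' hgper' hec))).2
    have b4 := (abs_le.1 (abs_integral_sq_mul_le hec hU'c (abs_circConv_le hg' hgper' hec))).1
    have hM' := mul_le_mul_of_nonneg_left (hρdM t ht)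
      (mul_nonneg (L2norm_nonneg (deriv gTilde)) (sq_nonneg (L2norm (e t))))
    have hL' := mul_le_mul_of_nonneg_left (hρdL t ht)
      (mul_nonneg (L2norm_nonneg gTilde) (sq_nonneg (L2norm (e t))))
    linarith
  all_goals exact Continuous.intervalIntegrable (by fun_prop) _ _
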